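/- arXiv:1306.3187 — 3 statements merged into one kernel-verified Lean document; each statement's English description precedes it below -/
import Mathlib

section
/- Let V be a finite-dimensional real inner product space, K a compact topological group acting continuously on V by orthogonal linear transformations, A ⊆ V a K-invariant affine subspace with linear part (direction) V(A), and x₀ ∈ A. Then the convex hull Conv(K·x₀) of the orbit K·x₀ has empty interior in A (with respect to the subspace topology of A) if and only if there exists a proper K-invariant linear subspace W ⊊ V(A) such that x₀ ∈ V_K + W, where V_K = {x ∈ V : k·x = x for all k ∈ K} is the subspace of K-stationary points. -/
/-- If the affine span of a nonempty convex set `s` is `A`, then `s` has nonempty interior in `A`. -/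
theorem Convex.interior_preimage_nonempty {V : Type*} [NormedAddCommGroup V] [NormedSpace ℝ V]
    [FiniteDimensional ℝ V] {s : Set V} (hs : Convex ℝ s) (hne : s.Nonempty)
    {A : AffineSubspace ℝ V} (hA : affineSpan ℝ s = A) :
    (interior ((Subtype.val : A → V) ⁻¹' s)).Nonempty := by
  subst hA
  exact Set.image_nonempty.mp (hne.intrinsicInterior hs)

/-- A submodule containing all differences of points of a set with nonempty interior in an affine
subspace contains the direction of that affine subspace. -/
theorem AffineSubspace.direction_le_of_interior_nonempty {V : Type*} [NormedAddCommGroup V]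
    [NormedSpace ℝ V] {A : AffineSubspace ℝ V} {s : Set V} {W : Submodule ℝ V}
    (hs : ∀ x ∈ s, ∀ y ∈ s, x - y ∈ W)
    (hne : (interior ((Subtype.val : A → V) ⁻¹' s)).Nonempty) : A.direction ≤ W := by
  intro d hd
  obtain ⟨a, ha⟩ := hne
  have hmem (t : ℝ) : t • d + (a : V) ∈ A :=
    A.vadd_mem_of_mem_direction (A.direction.smul_mem t hd) a.2
  let f : ℝ → A := fun t => ⟨t • d + (a : V), hmem t⟩
  have hf : Continuous f := by fun_prop
  have hf0 : f 0 = a := by simp [f]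
  have hnhds : ∀ᶠ t in nhds (0 : ℝ), f t ∈ interior ((Subtype.val : A → V) ⁻¹' s) :=
    hf.continuousAt.eventually (hf0 ▸ isOpen_interior.mem_nhds ha)
  obtain ⟨t, ht, ht0⟩ := ((hnhds.filter_mono nhdsWithin_le_nhds).and
    (self_mem_nhdsWithin : ∀ᶠ t in nhdsWithin (0 : ℝ) {0}ᶜ, t ∈ ({0}ᶜ : Set ℝ))).exists
  have h := hs (f t) (interior_subset ht :) a (interior_subset ha :)
  exact (W.smul_mem_iff ht0).mp (by simpa [f] using h)

/-- The span of the differences of points of an orbit of a linear action is invariant. -/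
theorem smul_mem_vectorSpan_orbit {V K : Type*} [AddCommGroup V] [Module ℝ V] [Group K]
    [MulAction K V] (hlin : ∀ k : K, IsLinearMap ℝ (fun v : V => k • v)) (x : V) (k : K) {w : V}
    (hw : w ∈ vectorSpan ℝ (MulAction.orbit K x)) :
    k • w ∈ vectorSpan ℝ (MulAction.orbit K x) := by
  suffices h : vectorSpan ℝ (MulAction.orbit K x) ≤
      (vectorSpan ℝ (MulAction.orbit K x)).comap (hlin k).mk' from h hw
  refine Submodule.span_le.mpr ?_
  rintro _ ⟨y, hy, z, hz, rfl⟩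
  have h : k • (y - z) = k • y - k • z := (hlin k).map_sub y z
  simpa [h] using vsub_mem_vectorSpan ℝ (MulAction.mem_orbit_of_mem_orbit k hy)
    (MulAction.mem_orbit_of_mem_orbit k hz)

/-- If `W` is invariant under an isometric linear action and contains all displacements of `x`,
then the component of `x` orthogonal to `W` is fixed. -/
theorem smul_sub_starProjection_eq {V K : Type*} [NormedAddCommGroup V] [InnerProductSpace ℝ V]
    [Group K] [MulAction K V] (hlin : ∀ k : K, IsLinearMap ℝ (fun v : V => k • v))
    (hiso : ∀ (k : K) (v : V), ‖k • v‖ = ‖v‖) {W : Submodule ℝ V} [W.HasOrthogonalProjection]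
    (hW : ∀ (k : K), ∀ w ∈ W, k • w ∈ W) {x : V} (hx : ∀ k : K, k • x - x ∈ W) (k : K) :
    k • (x - W.starProjection x) = x - W.starProjection x := by
  set w := W.starProjection x
  set v := x - w with hv
  have hw : w ∈ W := W.starProjection_apply_mem x
  have hdiff : k • v - v ∈ W := by
    have h : k • v = k • x - k • w := (hlin k).map_sub x w
    have h' : k • v - v = (k • x - x) - (k • w - w) := by rw [h, hv]; abel
    exact h' ▸ W.sub_mem (hx k) (W.sub_mem (hW k w hw) hw)
  have horth : inner ℝ v (k • v - v) = 0 :=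
    W.inner_left_of_mem_orthogonal hdiff (W.sub_starProjection_mem_orthogonal x)
  have hpyth := norm_add_sq_eq_norm_sq_add_norm_sq_real horth
  rw [add_sub_cancel, hiso] at hpyth
  exact sub_eq_zero.mp (norm_eq_zero.mp (mul_self_eq_zero.mp (by linarith)))


/-- Let `V` be a finite-dimensional real inner product space, `K` a compact
topological group acting continuously on `V` by orthogonal linear transformations,
`A ⊆ V` a `K`-invariant affine subspace with linear part (direction) `V(A)`, and `x₀ ∈ A`.
Then the convex hull of the orbit `K · x₀` has empty interior in `A` (with the subspace
topology of `A`) if and only if there exists a proper `K`-invariant linear subspace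
`W ⊊ V(A)` such that `x₀ ∈ V_K + W`, where `V_K` is the set of `K`-stationary points. -/
theorem stmt0 {V : Type*} [NormedAddCommGroup V] [InnerProductSpace ℝ V]
    [FiniteDimensional ℝ V]
    {K : Type*} [Group K] [TopologicalSpace K] [CompactSpace K]
    [MulAction K V] [ContinuousSMul K V]
    (hlin : ∀ k : K, IsLinearMap ℝ (fun v : V => k • v))
    (hiso : ∀ (k : K) (v : V), ‖k • v‖ = ‖v‖)
    (A : AffineSubspace ℝ V)
    (hAinv : ∀ (k : K), ∀ a ∈ A, k • a ∈ A)
    (x₀ : V) (hx₀ : x₀ ∈ A) :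
    interior ((Subtype.val : A → V) ⁻¹' (convexHull ℝ (MulAction.orbit K x₀))) = ∅ ↔
      ∃ W : Submodule ℝ V, W < A.direction ∧ (∀ (k : K), ∀ w ∈ W, k • w ∈ W) ∧
        ∃ v w : V, (∀ k : K, k • v = v) ∧ w ∈ W ∧ x₀ = v + w := by
  constructor
  · intro hint
    have hself : x₀ ∈ MulAction.orbit K x₀ := MulAction.mem_orbit_self x₀
    have hWinv := fun (k : K) w => smul_mem_vectorSpan_orbit hlin x₀ k (w := w)
    have hle : affineSpan ℝ (MulAction.orbit K x₀) ≤ A := by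
      refine affineSpan_le.mpr ?_
      rintro _ ⟨k, rfl⟩
      exact hAinv k x₀ hx₀
    refine ⟨vectorSpan ℝ (MulAction.orbit K x₀), lt_of_le_of_ne ?_ ?_, hWinv,
      x₀ - (vectorSpan ℝ (MulAction.orbit K x₀)).starProjection x₀, _,
      smul_sub_starProjection_eq hlin hiso hWinv fun k =>
        vsub_mem_vectorSpan ℝ (MulAction.mem_orbit x₀ k) hself,
      Submodule.starProjection_apply_mem _ x₀, (sub_add_cancel _ _).symm⟩
    · simpa only [direction_affineSpan] using AffineSubspace.direction_le hle
    · intro heq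
      have hspan : affineSpan ℝ (MulAction.orbit K x₀) = A :=
        AffineSubspace.ext_of_direction_eq (by rw [direction_affineSpan, heq])
          ⟨x₀, mem_affineSpan ℝ hself, hx₀⟩
      exact ((convex_convexHull ℝ _).interior_preimage_nonempty
        (convexHull_nonempty_iff.mpr ⟨x₀, hself⟩)
        ((affineSpan_convexHull _).trans hspan)).ne_empty hint
  · rintro ⟨W, hWA, hW, v, w, hv, hw, rfl⟩
    by_contra hne
    refine hWA.not_ge (AffineSubspace.direction_le_of_interior_nonempty ?_
      (Set.nonempty_iff_ne_empty.mpr hne))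
    have hsub : convexHull ℝ (MulAction.orbit K (v + w)) ⊆ AffineSubspace.mk' v W := by
      refine convexHull_min ?_ (AffineSubspace.convex _)
      rintro _ ⟨k, rfl⟩
      have h : k • (v + w) = k • v + k • w := (hlin k).map_add v w
      simpa [AffineSubspace.mem_mk', h, hv k] using hW k w hw
    intro x hx y hy
    simpa using AffineSubspace.vsub_mem_direction (hsub hx) (hsub hy)
end

section
/- Let H₁, H₂ be finite-dimensional complex Hilbert spaces with dim(H₁) ≥ dim(H₂) > 1, set H = H₁⊗H₂, and let ψ ∈ H be a unit vector. The pure state P_ψ is maximally entangled if and only if the convex hull Conv(K·P_ψ) of the orbit of P_ψ under the local unitary group K = U(H₁)×U(H₂), acting by (U₁,U₂)·A = (U₁⊗U₂) A (U₁⊗U₂)†, has empty interior in the affine space u*₁(H) of trace-one Hermitian operators on H. -/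
open Matrix
open scoped Kronecker

noncomputable section

/-- The pure state (rank-one projection) `|ψ⟩⟨ψ|` associated with a vector `ψ`. -/
def pureState {n : Type*} [Fintype n] (ψ : n → ℂ) : Matrix n n ℂ :=
  Matrix.vecMulVec ψ (star ψ)

/-- `ψ` is a unit vector. -/
def IsUnitVec {n : Type*} [Fintype n] (ψ : n → ℂ) : Prop :=
  ∑ p, Complex.normSq (ψ p) = 1

/-- A family of vectors is an orthonormal system. -/
def ONFamily {ι n : Type*} [DecidableEq ι] [Fintype n] (v : ι → n → ℂ) : Prop :=
  ∀ i j, (∑ p, (starRingEnd ℂ) (v i p) * v j p) = if i = j then 1 else 0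

/-- Maximally entangled unit vector in `H₁ ⊗ H₂`, `dim H₁ = d₁ ≥ dim H₂ = d₂`. -/
def MaxEnt (d₁ d₂ : ℕ) (ψ : Fin d₁ × Fin d₂ → ℂ) : Prop :=
  ∃ (a : Fin d₂ → Fin d₁ → ℂ) (b : Fin d₂ → Fin d₂ → ℂ),
    ONFamily a ∧ ONFamily b ∧
    ∀ p, ψ p = ((Real.sqrt d₂ : ℂ))⁻¹ * ∑ j, a j p.1 * b j p.2

/-- The orbit of a Hermitian operator `A` on `H₁ ⊗ H₂` under the local unitary group
`K = U(H₁) × U(H₂)` acting by `(U₁,U₂)·A = (U₁ ⊗ U₂) A (U₁ ⊗ U₂)†`. -/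
def localOrbit (d₁ d₂ : ℕ) (A : Matrix (Fin d₁ × Fin d₂) (Fin d₁ × Fin d₂) ℂ) :
    Set (Matrix (Fin d₁ × Fin d₂) (Fin d₁ × Fin d₂) ℂ) :=
  {B | ∃ U₁ ∈ Matrix.unitaryGroup (Fin d₁) ℂ, ∃ U₂ ∈ Matrix.unitaryGroup (Fin d₂) ℂ,
    B = (U₁ ⊗ₖ U₂) * A * (U₁ ⊗ₖ U₂)ᴴ}

/-- The affine space `u*₁(H)` of trace-one Hermitian operators on `H`. -/
def traceOne (n : Type*) [Fintype n] [DecidableEq n] : Set (Matrix n n ℂ) :=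
  {A | A.IsHermitian ∧ A.trace = 1}

section LieClosure

variable {m n : Type*} [Fintype m] [DecidableEq m] [Fintype n] [DecidableEq n]

theorem one_add_smul_mem_unitaryGroup {P : Matrix m m ℂ} (hP : Pᴴ = P) (hPP : P * P = P)
    {z : ℂ} (hz : star z * z = 1) :
    (1 + (z - 1) • P) ∈ Matrix.unitaryGroup m ℂ := by
  rw [Matrix.mem_unitaryGroup_iff', star_eq_conjTranspose]
  have h : (star z - 1) + (z - 1) + (z - 1) * (star z - 1) = 0 := by linear_combination hz
  calc (1 + (z - 1) • P)ᴴ * (1 + (z - 1) • P)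
      = 1 + ((star z - 1) + (z - 1) + (z - 1) * (star z - 1)) • P := by
        simp only [conjTranspose_add, conjTranspose_smul, conjTranspose_one, hP, add_mul, mul_add,
          mul_one, one_mul, smul_mul_assoc, mul_smul_comm, hPP, star_sub, star_one]
        module
    _ = 1 := by rw [h, zero_smul, add_zero]

theorem commutator_mem_of_phase_conj_mem {P : Matrix n n ℂ} (hP : Pᴴ = P)
    {S : Submodule ℂ (Matrix n n ℂ)}
    (h : ∀ z : ℂ, star z * z = 1 → ∀ X ∈ S,
      (1 + (z - 1) • P) * X * (1 + (z - 1) • P)ᴴ ∈ S)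
    {X : Matrix n n ℂ} (hX : X ∈ S) : P * X - X * P ∈ S := by
  have expand (z : ℂ) : (1 + (z - 1) • P) * X * (1 + (z - 1) • P)ᴴ =
      X + (z - 1) • (P * X) + (star z - 1) • (X * P) + ((z - 1) * (star z - 1)) • (P * X * P) := by
    simp only [conjTranspose_add, conjTranspose_smul, conjTranspose_one, hP, add_mul, mul_add,
      mul_one, one_mul, smul_mul_assoc, mul_smul_comm, star_sub, star_one]
    module
  have h1 := h (-1) (by simp) X hX
  have h2 := h Complex.I (by simp) X hX
  rw [expand] at h1 h2
  have h3 := S.smul_mem (-Complex.I) (S.sub_mem (S.sub_mem h2 (S.smul_mem (1 / 2) h1))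
    (S.smul_mem (1 / 2) hX))
  convert h3 using 1
  simp only [Complex.star_def, Complex.conj_I, star_neg, star_one]
  have hI := Complex.I_mul_I
  match_scalars <;> first
    | ring1
    | linear_combination hI
    | linear_combination -hI
    | linear_combination Complex.I * hI
    | linear_combination (-Complex.I) * hI

omit [DecidableEq m] in
theorem polarization_vecMulVec (x y : m → ℂ) :
    vecMulVec x (star y) = (1 / 4 : ℂ) • (pureState (x + y) - pureState (x - y)
      + Complex.I • pureState (x + Complex.I • y) - Complex.I • pureState (x - Complex.I • y)) := by
  ext i j
  simp only [pureState, vecMulVec_apply, Matrix.smul_apply, Matrix.sub_apply, Matrix.add_apply,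
    Pi.add_apply, Pi.sub_apply, Pi.smul_apply, Pi.star_apply, star_add, star_sub, smul_eq_mul, star_mul', Complex.star_def, Complex.conj_I]
  linear_combination (1 / 2 * x i * (starRingEnd ℂ) (y j) -
    1 / 2 * y i * (starRingEnd ℂ) (x j)) * Complex.I_mul_I

open scoped ComplexOrder in
/-- A complex subspace invariant under conjugation by the image of the unitary group is invariant
under commutators with the image of the full matrix algebra. -/
theorem commutator_mem_of_unitary_conj_mem (F : Matrix m m ℂ →⋆ₐ[ℂ] Matrix n n ℂ)
    {S : Submodule ℂ (Matrix n n ℂ)}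
    (h : ∀ U ∈ Matrix.unitaryGroup m ℂ, ∀ X ∈ S, F U * X * (F U)ᴴ ∈ S)
    (A : Matrix m m ℂ) {X : Matrix n n ℂ} (hX : X ∈ S) : F A * X - X * F A ∈ S := by
  let f : Matrix m m ℂ →ₗ[ℂ] Matrix n n ℂ :=
    (LinearMap.mulRight ℂ X - LinearMap.mulLeft ℂ X) ∘ₗ F.toAlgHom.toLinearMap
  have hf (B) : f B = F B * X - X * F B := rfl
  have hpure (x : m → ℂ) : pureState x ∈ S.comap f := by
    have hH : (pureState x)ᴴ = pureState x := by simp [pureState, conjTranspose_vecMulVec]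
    by_cases hx : star x ⬝ᵥ x = 0
    · rw [dotProduct_star_self_eq_zero] at hx
      simp [pureState, hx]
    set s := star x ⬝ᵥ x with hs
    have hsq : pureState x * pureState x = s • pureState x := by
      simp [pureState, vecMulVec_mul_vecMulVec, hs]
    have hstar : star s = s := by rw [hs, ← star_dotProduct_star, star_star, dotProduct_comm]
    set P := s⁻¹ • pureState x with hPdef
    have hP : Pᴴ = P := by rw [hPdef, conjTranspose_smul, hH, star_inv₀, hstar]
    have hPP : P * P = P := by
      rw [hPdef, smul_mul_smul_comm, hsq, smul_smul, mul_assoc, inv_mul_cancel₀ hx, mul_one]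
    have hFP : (F P)ᴴ = F P := by
      rw [← star_eq_conjTranspose, ← map_star, star_eq_conjTranspose, hP]
    have : P ∈ S.comap f := by
      refine commutator_mem_of_phase_conj_mem hFP (fun z hz Y hY ↦ ?_) hX
      simpa using h _ (one_add_smul_mem_unitaryGroup hP hPP hz) Y hY
    have h2 := (S.comap f).smul_mem s this
    rwa [hPdef, smul_smul, mul_inv_cancel₀ hx, one_smul] at h2
  have hvec (x y : m → ℂ) : vecMulVec x (star y) ∈ S.comap f := by
    rw [polarization_vecMulVec]
    have := hpure
    exact Submodule.smul_mem _ _ (sub_mem (add_mem (sub_mem (this _) (this _))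
      (Submodule.smul_mem _ _ (this _))) (Submodule.smul_mem _ _ (this _)))
  have hA : A ∈ S.comap f := by
    rw [matrix_eq_sum_single A]
    refine sum_mem fun i _ ↦ sum_mem fun j _ ↦ ?_
    have := (S.comap f).smul_mem (A i j) (hvec (Pi.single i 1) (Pi.single j 1))
    rwa [show star (Pi.single j (1 : ℂ)) = (Pi.single j 1 : m → ℂ) by
      rw [← Pi.single_star, star_one],
      ← single_eq_single_vecMulVec_single, smul_single, smul_eq_mul, mul_one] at this
  exact hA

/-- An ideal of the Lie algebra of matrices that contains an off-diagonal matrix unit contains all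
traceless matrices. -/
theorem mem_of_trace_eq_zero_of_single_mem {T : Submodule ℂ (Matrix m m ℂ)}
    (hT : ∀ A, ∀ B ∈ T, A * B - B * A ∈ T) {i j : m} (hij : i ≠ j) (h : single i j 1 ∈ T)
    {A : Matrix m m ℂ} (hA : A.trace = 0) : A ∈ T := by
  have right {a b c : m} (hab : single a b (1 : ℂ) ∈ T) (hac : a ≠ c) : single a c (1 : ℂ) ∈ T := by
    have := T.neg_mem (hT (single b c 1) _ hab)
    simpa [single_mul_single_of_ne (1 : ℂ) _ _ _ hac.symm] using this
  have left {a b c : m} (hab : single a b (1 : ℂ) ∈ T) (hcb : c ≠ b) : single c b (1 : ℂ) ∈ T := by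
    have := hT (single c a 1) _ hab
    simpa [single_mul_single_of_ne (1 : ℂ) _ _ _ hcb.symm] using this
  have flip {a b : m} (hab : single a b (1 : ℂ) ∈ T) (hne : a ≠ b) : single b a (1 : ℂ) ∈ T := by
    have := T.smul_mem (-1/2) (hT (single b a 1) _ (hT (single b a 1) _ hab))
    convert this using 1
    simp [mul_sub, sub_mul, single_mul_single_of_ne (1 : ℂ) _ _ _ hne]
    module
  have offdiag {k l : m} (hkl : k ≠ l) : single k l (1 : ℂ) ∈ T := by
    by_cases hkj : k = j
    · subst hkj
      exact right (flip h hij) hkl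
    · exact right (left h hkj) hkl
  have key (a k l : m) :
      single k l (1 : ℂ) - (if k = l then 1 else 0 : ℂ) • single a a (1 : ℂ) ∈ T := by
    by_cases hkl : k = l
    · subst hkl
      by_cases hka : k = a
      · simp [hka]
      · simpa using hT (single k a 1) _ (offdiag (Ne.symm hka))
    · simpa [hkl] using offdiag hkl
  have : A = ∑ k, ∑ l, A k l •
      (single k l (1 : ℂ) - (if k = l then 1 else 0 : ℂ) • single i i (1 : ℂ)) := by
    have htr : ∑ k, A k k = 0 := hA
    conv_lhs => rw [matrix_eq_sum_single A]
    simp only [smul_sub, Finset.sum_sub_distrib, smul_smul, ← Finset.sum_smul]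
    simp [htr]
  rw [this]
  exact sum_mem fun k _ ↦ sum_mem fun l _ ↦ T.smul_mem _ (key i k l)

end LieClosure

theorem mul_mul_mem_of_commutator_mem {R : Type*} [Ring R] [Algebra ℂ R] {S : Submodule ℂ R}
    {e f : R} (hee : e * e = e) (hef : e * f = 0) (hfe : f * e = 0)
    (he : ∀ X ∈ S, e * X - X * e ∈ S) (hf : ∀ X ∈ S, f * X - X * f ∈ S)
    {X : R} (hX : X ∈ S) : e * X * f ∈ S := by
  have h1 := he _ (hf X hX)
  have h2 := he _ h1
  have e1 : e * (f * X - X * f) - (f * X - X * f) * e = -(e * X * f) - f * X * e := by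
    calc _ = e * f * X - e * X * f - f * X * e + X * (f * e) := by noncomm_ring
      _ = _ := by rw [hef, hfe]; noncomm_ring
  rw [e1] at h1 h2
  have e2 : e * (-(e * X * f) - f * X * e) - (-(e * X * f) - f * X * e) * e
      = -(e * X * f) + f * X * e := by
    calc _ = -(e * e * X * f) - e * f * X * e + e * X * (f * e) + f * X * (e * e) := by noncomm_ring
      _ = _ := by rw [hee, hef, hfe]; noncomm_ring
  rw [e2] at h2
  have h3 := S.smul_mem (-1 / 2 : ℂ) (S.add_mem h1 h2)
  convert h3 using 1
  module

section Bipartite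

variable {p q : Type*} [Fintype p] [DecidableEq p] [Fintype q] [DecidableEq q]

/-- The embedding `A ↦ A ⊗ 1` of local operators on the first factor. -/
def kroneckerOneHom (p q : Type*) [Fintype p] [DecidableEq p] [Fintype q] [DecidableEq q] :
    Matrix p p ℂ →⋆ₐ[ℂ] Matrix (p × q) (p × q) ℂ where
  toFun A := A ⊗ₖ 1
  map_one' := one_kronecker_one
  map_mul' A B := by rw [← mul_kronecker_mul, one_mul]
  map_zero' := zero_kronecker _
  map_add' A B := add_kronecker _ _ _
  commutes' c := by simp [Algebra.algebraMap_eq_smul_one, smul_kronecker]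
  map_star' A := by simp [star_eq_conjTranspose, conjTranspose_kronecker]

/-- The embedding `B ↦ 1 ⊗ B` of local operators on the second factor. -/
def oneKroneckerHom (p q : Type*) [Fintype p] [DecidableEq p] [Fintype q] [DecidableEq q] :
    Matrix q q ℂ →⋆ₐ[ℂ] Matrix (p × q) (p × q) ℂ where
  toFun B := 1 ⊗ₖ B
  map_one' := one_kronecker_one
  map_mul' A B := by rw [← mul_kronecker_mul, one_mul]
  map_zero' := kronecker_zero _
  map_add' A B := kronecker_add _ _ _
  commutes' c := by simp [Algebra.algebraMap_eq_smul_one, kronecker_smul]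
  map_star' A := by simp [star_eq_conjTranspose, conjTranspose_kronecker]

/-- A subspace of operators on the tensor product is a local ideal if it is stable under
commutators with all operators acting on a single factor. -/
structure IsLocalIdeal (S : Submodule ℂ (Matrix (p × q) (p × q) ℂ)) : Prop where
  left : ∀ A : Matrix p p ℂ, ∀ X ∈ S, (A ⊗ₖ (1 : Matrix q q ℂ)) * X - X * (A ⊗ₖ 1) ∈ S
  right : ∀ B : Matrix q q ℂ, ∀ X ∈ S, ((1 : Matrix p p ℂ) ⊗ₖ B) * X - X * (1 ⊗ₖ B) ∈ S

theorem single_kronecker_one_mul_apply (X : Matrix (p × q) (p × q) ℂ) (i j : p) (k : q) (r) :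
    ((single i j (1 : ℂ) ⊗ₖ (1 : Matrix q q ℂ)) * X) (i, k) r = X (j, k) r := by
  simp [mul_apply, Fintype.sum_prod_type, single_apply, one_apply]

theorem mul_single_kronecker_one_apply (X : Matrix (p × q) (p × q) ℂ) (i j : p) (k : q) (r) :
    (X * (single i j (1 : ℂ) ⊗ₖ (1 : Matrix q q ℂ))) r (j, k) = X r (i, k) := by
  simp [mul_apply, Fintype.sum_prod_type, single_apply, one_apply]

theorem one_kronecker_single_mul_apply (X : Matrix (p × q) (p × q) ℂ) (i : p) (k l : q) (r) :
    (((1 : Matrix p p ℂ) ⊗ₖ single k l (1 : ℂ)) * X) (i, k) r = X (i, l) r := by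
  simp [mul_apply, Fintype.sum_prod_type, single_apply, one_apply]

theorem mul_one_kronecker_single_apply (X : Matrix (p × q) (p × q) ℂ) (i : p) (k l : q) (r) :
    (X * ((1 : Matrix p p ℂ) ⊗ₖ single k l (1 : ℂ))) r (i, l) = X r (i, k) := by
  simp [mul_apply, Fintype.sum_prod_type, single_apply, one_apply]

theorem single_kronecker_one_mul_mul (X : Matrix (p × q) (p × q) ℂ) (i j : p) :
    (single i i (1 : ℂ) ⊗ₖ (1 : Matrix q q ℂ)) * X * (single j j (1 : ℂ) ⊗ₖ (1 : Matrix q q ℂ)) =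
      single i j (1 : ℂ) ⊗ₖ of fun k l ↦ X (i, k) (j, l) := by
  ext ⟨a, k⟩ ⟨b, l⟩
  by_cases ha : i = a <;> by_cases hb : j = b <;>
  simp [mul_apply, Fintype.sum_prod_type, single_apply, one_apply, ha, hb]

theorem one_kronecker_single_mul_mul (X : Matrix (p × q) (p × q) ℂ) (k l : q) :
    ((1 : Matrix p p ℂ) ⊗ₖ single k k (1 : ℂ)) * X * ((1 : Matrix p p ℂ) ⊗ₖ single l l (1 : ℂ)) =
      (of fun i j ↦ X (i, k) (j, l)) ⊗ₖ single k l (1 : ℂ) := by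
  ext ⟨i, a⟩ ⟨j, b⟩
  by_cases ha : k = a <;> by_cases hb : l = b <;>
  simp [mul_apply, Fintype.sum_prod_type, single_apply, one_apply, ha, hb]

namespace IsLocalIdeal

variable {S : Submodule ℂ (Matrix (p × q) (p × q) ℂ)}

theorem single_kronecker_block_mem (hS : IsLocalIdeal S) {X : Matrix (p × q) (p × q) ℂ} (hX : X ∈ S)
    {i j : p} (hij : i ≠ j) :
    single i j (1 : ℂ) ⊗ₖ (of fun k l ↦ X (i, k) (j, l)) ∈ S := by
  rw [← single_kronecker_one_mul_mul]
  refine mul_mul_mem_of_commutator_mem ?_ ?_ ?_ (hS.left _) (hS.left _) hX <;>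
    rw [← mul_kronecker_mul]
  · simp
  · simp [single_mul_single_of_ne (1 : ℂ) _ _ _ hij]
  · simp [single_mul_single_of_ne (1 : ℂ) _ _ _ hij.symm]

theorem block_kronecker_single_mem (hS : IsLocalIdeal S) {X : Matrix (p × q) (p × q) ℂ} (hX : X ∈ S)
    {k l : q} (hkl : k ≠ l) :
    (of fun i j ↦ X (i, k) (j, l)) ⊗ₖ single k l (1 : ℂ) ∈ S := by
  rw [← one_kronecker_single_mul_mul]
  refine mul_mul_mem_of_commutator_mem ?_ ?_ ?_ (hS.right _) (hS.right _) hX <;>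
    rw [← mul_kronecker_mul]
  · simp
  · simp [single_mul_single_of_ne (1 : ℂ) _ _ _ hkl]
  · simp [single_mul_single_of_ne (1 : ℂ) _ _ _ hkl.symm]

theorem kronecker_mem_of_single_left (hS : IsLocalIdeal S) {B : Matrix q q ℂ} {i j : p}
    (hij : i ≠ j) (h : single i j (1 : ℂ) ⊗ₖ B ∈ S) {A : Matrix p p ℂ} (hA : A.trace = 0) :
    A ⊗ₖ B ∈ S := by
  let T : Submodule ℂ (Matrix p p ℂ) := S.comap ((kroneckerBilinear (R := ℂ) (α := ℂ)).flip B)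
  refine mem_of_trace_eq_zero_of_single_mem (T := T) (fun C D hD ↦ ?_) hij h hA
  have := hS.left C _ hD
  have e : (C * D - D * C) ⊗ₖ B = C ⊗ₖ (1 : Matrix q q ℂ) * D ⊗ₖ B - D ⊗ₖ B * C ⊗ₖ 1 := by
    rw [← mul_kronecker_mul, ← mul_kronecker_mul, one_mul, mul_one]
    ext; simp [sub_mul]
  change (C * D - D * C) ⊗ₖ B ∈ S
  rwa [e]

theorem kronecker_mem_of_single_right (hS : IsLocalIdeal S) {A : Matrix p p ℂ} {k l : q}
    (hkl : k ≠ l) (h : A ⊗ₖ single k l (1 : ℂ) ∈ S) {B : Matrix q q ℂ} (hB : B.trace = 0) :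
    A ⊗ₖ B ∈ S := by
  let T : Submodule ℂ (Matrix q q ℂ) := S.comap (kroneckerBilinear (R := ℂ) (α := ℂ) A)
  refine mem_of_trace_eq_zero_of_single_mem (T := T) (fun C D hD ↦ ?_) hkl h hB
  have := hS.right C _ hD
  have e : A ⊗ₖ (C * D - D * C) = (1 : Matrix p p ℂ) ⊗ₖ C * A ⊗ₖ D - A ⊗ₖ D * 1 ⊗ₖ C := by
    rw [← mul_kronecker_mul, ← mul_kronecker_mul, one_mul, mul_one]
    ext; simp [mul_sub]
  change A ⊗ₖ (C * D - D * C) ∈ S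
  rwa [e]

theorem kronecker_mem_of_apply_ne_zero (hS : IsLocalIdeal S) {X : Matrix (p × q) (p × q) ℂ}
    (hX : X ∈ S) {i j : p} {k l : q} (hij : i ≠ j) (hkl : k ≠ l) (h : X (i, k) (j, l) ≠ 0)
    {A : Matrix p p ℂ} {B : Matrix q q ℂ} (hA : A.trace = 0) (hB : B.trace = 0) :
    A ⊗ₖ B ∈ S := by
  have h1 := hS.block_kronecker_single_mem (hS.single_kronecker_block_mem hX hij) hkl
  have h2 : (of fun a b ↦ (single i j (1 : ℂ) ⊗ₖ (of fun k l ↦ X (i, k) (j, l))) (a, k) (b, l)) =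
      X (i, k) (j, l) • single i j (1 : ℂ) := by
    ext a b
    simp [mul_comm]
  rw [h2, smul_kronecker] at h1
  have h3 := S.smul_mem (X (i, k) (j, l))⁻¹ h1
  rw [smul_smul, inv_mul_cancel₀ h, one_smul] at h3
  exact hS.kronecker_mem_of_single_right hkl (hS.kronecker_mem_of_single_left hij h3 hA) hB

theorem kronecker_one_mem [Nonempty q] (hS : IsLocalIdeal S)
    (hcorr : ∀ (A : Matrix p p ℂ) (B : Matrix q q ℂ), A.trace = 0 → B.trace = 0 → A ⊗ₖ B ∈ S)
    {X : Matrix (p × q) (p × q) ℂ} (hX : X ∈ S)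
    (h : ¬ ∃ c : ℂ, ∀ i j, ∑ k, X (i, k) (j, k) = if i = j then c else 0)
    {A : Matrix p p ℂ} (hA : A.trace = 0) : A ⊗ₖ (1 : Matrix q q ℂ) ∈ S := by
  obtain ⟨Y, hY, i, j, hij, hYij⟩ :
      ∃ Y ∈ S, ∃ i j, i ≠ j ∧ ∑ k, Y (i, k) (j, k) ≠ 0 := by
    by_contra! hcon
    refine h ?_
    rcases isEmpty_or_nonempty p with hp | ⟨⟨a⟩⟩
    · exact ⟨0, fun i ↦ isEmptyElim i⟩
    refine ⟨∑ k, X (a, k) (a, k), fun i j ↦ ?_⟩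
    split_ifs with hij
    · subst hij
      by_cases hia : i = a
      · rw [hia]
      · have := hcon _ (hS.left (single i a 1) X hX) i a hia
        simp only [Matrix.sub_apply, single_kronecker_one_mul_apply, mul_single_kronecker_one_apply,
          Finset.sum_sub_distrib] at this
        linear_combination -this
    · exact hcon X hX i j hij
  set R : Matrix q q ℂ := of fun k l ↦ Y (i, k) (j, l) with hR
  have hRtr : R.trace ≠ 0 := hYij
  have h1 := hS.single_kronecker_block_mem hY hij
  rw [← hR] at h1
  have hcard : (Fintype.card q : ℂ) ≠ 0 := by simp
  have h2 := hcorr (single i j 1) (R - (R.trace / Fintype.card q) • 1) (by simp [trace, hij])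
    (by simp [hcard])
  have h3 := S.smul_mem (Fintype.card q / R.trace) (S.sub_mem h1 h2)
  have h4 : (Fintype.card q / R.trace : ℂ) • (single i j (1 : ℂ) ⊗ₖ R -
      single i j (1 : ℂ) ⊗ₖ (R - (R.trace / Fintype.card q : ℂ) • (1 : Matrix q q ℂ))) =
      single i j (1 : ℂ) ⊗ₖ 1 := by
    ext
    simp only [Matrix.smul_apply, Matrix.sub_apply, kroneckerMap_apply, smul_eq_mul]
    field_simp
    ring
  rw [h4] at h3
  exact hS.kronecker_mem_of_single_left hij h3 hA

theorem one_kronecker_mem [Nonempty p] (hS : IsLocalIdeal S)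
    (hcorr : ∀ (A : Matrix p p ℂ) (B : Matrix q q ℂ), A.trace = 0 → B.trace = 0 → A ⊗ₖ B ∈ S)
    {X : Matrix (p × q) (p × q) ℂ} (hX : X ∈ S)
    (h : ¬ ∃ c : ℂ, ∀ k l, ∑ i, X (i, k) (i, l) = if k = l then c else 0)
    {B : Matrix q q ℂ} (hB : B.trace = 0) : (1 : Matrix p p ℂ) ⊗ₖ B ∈ S := by
  obtain ⟨Y, hY, k, l, hkl, hYkl⟩ :
      ∃ Y ∈ S, ∃ k l, k ≠ l ∧ ∑ i, Y (i, k) (i, l) ≠ 0 := by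
    by_contra! hcon
    refine h ?_
    rcases isEmpty_or_nonempty q with hq | ⟨⟨a⟩⟩
    · exact ⟨0, fun i ↦ isEmptyElim i⟩
    refine ⟨∑ i, X (i, a) (i, a), fun k l ↦ ?_⟩
    split_ifs with hkl
    · subst hkl
      by_cases hka : k = a
      · rw [hka]
      · have := hcon _ (hS.right (single k a 1) X hX) k a hka
        simp only [Matrix.sub_apply, one_kronecker_single_mul_apply, mul_one_kronecker_single_apply,
          Finset.sum_sub_distrib] at this
        linear_combination -this
    · exact hcon X hX k l hkl
  set R : Matrix p p ℂ := of fun i j ↦ Y (i, k) (j, l) with hR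
  have hRtr : R.trace ≠ 0 := hYkl
  have h1 := hS.block_kronecker_single_mem hY hkl
  rw [← hR] at h1
  have hcard : (Fintype.card p : ℂ) ≠ 0 := by simp
  have h2 := hcorr (R - (R.trace / Fintype.card p) • 1) (single k l 1) (by simp [hcard])
    (by simp [trace, hkl])
  have h3 := S.smul_mem (Fintype.card p / R.trace) (S.sub_mem h1 h2)
  have h4 : (Fintype.card p / R.trace : ℂ) • (R ⊗ₖ single k l (1 : ℂ) -
      (R - (R.trace / Fintype.card p : ℂ) • (1 : Matrix p p ℂ)) ⊗ₖ single k l (1 : ℂ)) =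
      1 ⊗ₖ single k l (1 : ℂ) := by
    ext
    simp only [Matrix.smul_apply, Matrix.sub_apply, kroneckerMap_apply, smul_eq_mul]
    field_simp
    ring
  rw [h4] at h3
  exact hS.kronecker_mem_of_single_right hkl h3 hB

theorem eq_top_of_kronecker_mem [Nonempty p] [Nonempty q]
    (hcorr : ∀ (A : Matrix p p ℂ) (B : Matrix q q ℂ), A.trace = 0 → B.trace = 0 → A ⊗ₖ B ∈ S)
    (hleft : ∀ A : Matrix p p ℂ, A.trace = 0 → A ⊗ₖ (1 : Matrix q q ℂ) ∈ S)
    (hright : ∀ B : Matrix q q ℂ, B.trace = 0 → (1 : Matrix p p ℂ) ⊗ₖ B ∈ S)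
    {X : Matrix (p × q) (p × q) ℂ} (hX : X ∈ S) (htr : X.trace = 1) : S = ⊤ := by
  have hp : (Fintype.card p : ℂ) ≠ 0 := by simp
  have hq : (Fintype.card q : ℂ) ≠ 0 := by simp
  let f : Matrix (p × q) (p × q) ℂ →ₗ[ℂ] Matrix (p × q) (p × q) ℂ :=
    LinearMap.id - (traceLinearMap (p × q) ℂ ℂ).smulRight
      (((Fintype.card p : ℂ)⁻¹ * (Fintype.card q : ℂ)⁻¹) • 1)
  have hf (Y) : f Y = Y - Y.trace • ((Fintype.card p : ℂ)⁻¹ * (Fintype.card q : ℂ)⁻¹) • 1 := rfl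
  have hprod (A : Matrix p p ℂ) (B : Matrix q q ℂ) : f (A ⊗ₖ B) ∈ S := by
    set a := A.trace / Fintype.card p with ha
    set b := B.trace / Fintype.card q with hb
    have hA : (A - a • 1).trace = 0 := by simp [ha, hp]
    have hB : (B - b • 1).trace = 0 := by simp [hb, hq]
    have h := S.add_mem (S.add_mem (hcorr _ _ hA hB) (S.smul_mem b (hleft _ hA)))
      (S.smul_mem a (hright _ hB))
    convert h using 1
    rw [hf, trace_kronecker, ← one_kronecker_one]
    ext
    simp only [Matrix.smul_apply, Matrix.sub_apply, Matrix.add_apply, kroneckerMap_apply,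
      smul_eq_mul, ha, hb]
    field_simp
    ring
  have hall (Y) : f Y ∈ S := by
    change Y ∈ S.comap f
    rw [matrix_eq_sum_single Y]
    refine sum_mem fun i _ ↦ sum_mem fun j _ ↦ ?_
    have := (S.comap f).smul_mem (Y i j) (hprod (single i.1 j.1 1) (single i.2 j.2 1))
    simpa [single_kronecker_single, smul_single] using this
  have hone : ((Fintype.card p : ℂ)⁻¹ * (Fintype.card q : ℂ)⁻¹) • 1 ∈ S := by
    have := S.sub_mem hX (hall X)
    rwa [hf, htr, one_smul, sub_sub_cancel] at this
  refine eq_top_iff.2 fun Y _ ↦ ?_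
  have := S.add_mem (hall Y) (S.smul_mem Y.trace hone)
  rwa [hf, sub_add_cancel] at this

theorem exists_apply_ne_zero [Nontrivial p] [Nontrivial q] (hS : IsLocalIdeal S) {ψ : p × q → ℂ}
    (hψ : ψ ≠ 0) (h : pureState ψ ∈ S) :
    ∃ X ∈ S, ∃ i j k l, i ≠ j ∧ k ≠ l ∧ X (i, k) (j, l) ≠ 0 := by
  by_contra! hcon
  obtain ⟨⟨i, k⟩, hik⟩ := Function.ne_iff.1 hψ
  rw [Pi.zero_apply] at hik
  obtain ⟨j, hji⟩ := exists_ne i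
  obtain ⟨l, hlk⟩ := exists_ne k
  have e0 := hcon _ h i j k l hji.symm hlk.symm
  have e1 := hcon _ (hS.right (single l k 1) _ h) j i l k hji hlk
  have e2 := hcon _ (hS.left (single j i 1) _ h) j i l k hji hlk
  have e3 := hcon _ (hS.right (single l k 1) _ (hS.left (single j i 1) _ h)) j i l k hji hlk
  simp only [Matrix.sub_apply, one_kronecker_single_mul_apply, mul_one_kronecker_single_apply,
    single_kronecker_one_mul_apply, mul_single_kronecker_one_apply] at e1 e2 e3
  simp only [pureState, vecMulVec_apply, Pi.star_apply] at e0 e1 e2 e3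
  have hjl : ψ (j, l) = 0 := by simpa [hik] using e0
  have hjk : ψ (j, k) = 0 := by simpa [hik, hjl] using e1
  have hil : ψ (i, l) = 0 := by simpa [hik, hjl] using e2
  simp [hjl, hjk, hil, hik] at e3

theorem eq_top_of_pureState_mem [Nontrivial p] [Nontrivial q] (hS : IsLocalIdeal S) {ψ : p × q → ℂ}
    (hψ : (pureState ψ).trace = 1) (h : pureState ψ ∈ S)
    (h₁ : ¬ ∃ c : ℂ, ∀ i j, ∑ k, pureState ψ (i, k) (j, k) = if i = j then c else 0)
    (h₂ : ¬ ∃ c : ℂ, ∀ k l, ∑ i, pureState ψ (i, k) (i, l) = if k = l then c else 0) :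
    S = ⊤ := by
  have hψ0 : ψ ≠ 0 := by rintro rfl; simp [pureState] at hψ
  obtain ⟨X, hX, i, j, k, l, hij, hkl, hne⟩ := hS.exists_apply_ne_zero hψ0 h
  have hcorr (A : Matrix p p ℂ) (B : Matrix q q ℂ) (hA : A.trace = 0) (hB : B.trace = 0) :
      A ⊗ₖ B ∈ S := hS.kronecker_mem_of_apply_ne_zero hX hij hkl hne hA hB
  exact eq_top_of_kronecker_mem hcorr (fun _ ↦ hS.kronecker_one_mem hcorr h h₁)
    (fun _ ↦ hS.one_kronecker_mem hcorr h h₂) h hψ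

end IsLocalIdeal
end Bipartite

theorem mem_unitaryGroup_kronecker {p q : Type*} [Fintype p] [DecidableEq p] [Fintype q]
    [DecidableEq q] {U : Matrix p p ℂ} {V : Matrix q q ℂ} (hU : U ∈ Matrix.unitaryGroup p ℂ)
    (hV : V ∈ Matrix.unitaryGroup q ℂ) : U ⊗ₖ V ∈ Matrix.unitaryGroup (p × q) ℂ := by
  rw [mem_unitaryGroup_iff, star_eq_conjTranspose] at *
  rw [conjTranspose_kronecker, ← mul_kronecker_mul, hU, hV, one_kronecker_one]

theorem unitary_conj_mem_traceOne {n : Type*} [Fintype n] [DecidableEq n] {A U : Matrix n n ℂ}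
    (hA : A ∈ traceOne n) (hU : U ∈ Matrix.unitaryGroup n ℂ) : U * A * Uᴴ ∈ traceOne n := by
  refine ⟨?_, ?_⟩
  · rw [IsHermitian, conjTranspose_mul, conjTranspose_mul, conjTranspose_conjTranspose, hA.1.eq,
      Matrix.mul_assoc]
  · rw [mem_unitaryGroup_iff', star_eq_conjTranspose] at hU
    rw [trace_mul_cycle, hU, one_mul, hA.2]

theorem pureState_mem_traceOne {n : Type*} [Fintype n] [DecidableEq n] {ψ : n → ℂ}
    (hψ : IsUnitVec ψ) : pureState ψ ∈ traceOne n := by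
  refine ⟨by simp [IsHermitian, pureState, conjTranspose_vecMulVec], ?_⟩
  rw [pureState, trace_vecMulVec, dotProduct]
  simp only [Pi.star_apply, Complex.star_def, Complex.mul_conj]
  exact_mod_cast hψ

section Orbit

variable {d₁ d₂ : ℕ} {A : Matrix (Fin d₁ × Fin d₂) (Fin d₁ × Fin d₂) ℂ}

theorem localOrbit_subset_traceOne (hA : A ∈ traceOne (Fin d₁ × Fin d₂)) :
    localOrbit d₁ d₂ A ⊆ traceOne (Fin d₁ × Fin d₂) := by
  rintro _ ⟨U, hU, V, hV, rfl⟩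
  exact unitary_conj_mem_traceOne hA (mem_unitaryGroup_kronecker hU hV)

theorem self_mem_localOrbit : A ∈ localOrbit d₁ d₂ A :=
  ⟨1, one_mem _, 1, one_mem _, by simp⟩

theorem local_conj_mem_span_localOrbit {U : Matrix (Fin d₁) (Fin d₁) ℂ}
    {V : Matrix (Fin d₂) (Fin d₂) ℂ} (hU : U ∈ Matrix.unitaryGroup (Fin d₁) ℂ)
    (hV : V ∈ Matrix.unitaryGroup (Fin d₂) ℂ) {X : Matrix (Fin d₁ × Fin d₂) (Fin d₁ × Fin d₂) ℂ}
    (hX : X ∈ Submodule.span ℂ (localOrbit d₁ d₂ A)) :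
    (U ⊗ₖ V) * X * (U ⊗ₖ V)ᴴ ∈ Submodule.span ℂ (localOrbit d₁ d₂ A) := by
  let f := LinearMap.mulRight ℂ (U ⊗ₖ V)ᴴ ∘ₗ LinearMap.mulLeft ℂ (U ⊗ₖ V)
  refine (Submodule.span_le (p := (Submodule.span ℂ (localOrbit d₁ d₂ A)).comap f)).2 ?_ hX
  rintro _ ⟨U', hU', V', hV', rfl⟩
  refine Submodule.subset_span ⟨U * U', mul_mem hU hU', V * V', mul_mem hV hV', ?_⟩
  simp only [f, LinearMap.comp_apply, LinearMap.mulLeft_apply, LinearMap.mulRight_apply,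
    mul_kronecker_mul, conjTranspose_mul, Matrix.mul_assoc]

theorem isLocalIdeal_span_localOrbit : IsLocalIdeal (Submodule.span ℂ (localOrbit d₁ d₂ A)) where
  left B _ hX := commutator_mem_of_unitary_conj_mem (kroneckerOneHom _ _)
    (fun _ hU _ hX ↦ local_conj_mem_span_localOrbit hU (one_mem _) hX) B hX
  right B _ hX := commutator_mem_of_unitary_conj_mem (oneKroneckerHom _ _)
    (fun _ hV _ hX ↦ local_conj_mem_span_localOrbit (one_mem _) hV hX) B hX

end Orbit

theorem interior_convexHull_nonempty_of_basis {n ι : Type*} [Fintype n] [DecidableEq n] [Fintype ι]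
    [Nonempty ι] {O : Set (Matrix n n ℂ)} (hO : O ⊆ traceOne n)
    (b : Module.Basis ι ℂ (Matrix n n ℂ)) (hb : ∀ i, b i ∈ O) :
    (interior ((Subtype.val : traceOne n → Matrix n n ℂ) ⁻¹' convexHull ℝ O)).Nonempty := by
  have hreal (A : traceOne n) (i) : ((b.repr A i).re : ℂ) = b.repr A i := by
    have h : ∑ j, star (b.repr A j) • b j = A := by
      conv_rhs => rw [← A.2.1.eq, ← b.sum_repr A]
      simp only [conjTranspose_sum, conjTranspose_smul, (hO (hb _)).1.eq]
    have h' : b.repr A i = star (b.repr A i) := by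
      conv_lhs => rw [← h]
      rw [b.repr_sum_self]
    exact Complex.conj_eq_iff_re.1 h'.symm
  have hsum (A : traceOne n) : ∑ i, (b.repr A i).re = 1 := by
    have h := congrArg trace (b.sum_repr A)
    rw [trace_sum, A.2.2] at h
    simp only [trace_smul, (hO (hb _)).2, smul_eq_mul, mul_one] at h
    simpa using congrArg Complex.re h
  have hopen : IsOpen {A : traceOne n | ∀ i, 0 < (b.repr A i).re} := by
    rw [Set.ofPred_forall]
    refine isOpen_iInter_of_finite fun i ↦ isOpen_lt continuous_const ?_
    exact Complex.continuous_re.comp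
      ((b.coord i).continuous_of_finiteDimensional.comp continuous_subtype_val)
  have hsub : {A : traceOne n | ∀ i, 0 < (b.repr A i).re} ⊆ Subtype.val ⁻¹' convexHull ℝ O := by
    intro A hA
    have h := (convex_convexHull ℝ O).sum_mem (t := Finset.univ) (fun i _ ↦ (hA i).le) (hsum A)
      (fun i _ ↦ subset_convexHull ℝ O (hb i))
    have h' : ∑ i, (b.repr A i).re • b i = A := by
      conv_rhs => rw [← b.sum_repr A]
      refine Finset.sum_congr rfl fun i _ ↦ ?_
      rw [← hreal A i, Complex.coe_smul, Complex.ofReal_re]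
    rwa [h'] at h
  refine Set.Nonempty.mono (interior_maximal hsub hopen) ?_
  have hι : (Fintype.card ι : ℂ) ≠ 0 := Nat.cast_ne_zero.2 Fintype.card_ne_zero
  have hC : ∑ i, (Fintype.card ι : ℂ)⁻¹ • b i ∈ traceOne n := by
    refine ⟨?_, ?_⟩
    · simp [IsHermitian, conjTranspose_sum, conjTranspose_smul, (hO (hb _)).1.eq]
    · simp [trace_sum, trace_smul, (hO (hb _)).2, hι]
  refine ⟨⟨_, hC⟩, fun i ↦ ?_⟩
  rw [b.repr_sum_self, ← Complex.ofReal_natCast, ← Complex.ofReal_inv, Complex.ofReal_re]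
  exact inv_pos.2 (Nat.cast_pos.2 Fintype.card_pos)

/-- If trace-one Hermitian matrices span the whole matrix space, their convex hull has nonempty
interior in the space of trace-one Hermitian matrices. -/
theorem interior_convexHull_nonempty_of_span_eq_top {n : Type*} [Fintype n] [DecidableEq n]
    [Nonempty n] {O : Set (Matrix n n ℂ)} (hO : O ⊆ traceOne n) (hspan : Submodule.span ℂ O = ⊤) :
    (interior ((Subtype.val : traceOne n → Matrix n n ℂ) ⁻¹' convexHull ℝ O)).Nonempty := by
  let b := Module.Basis.ofSpan hspan.ge
  have := Module.Finite.finite_basis b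
  have := Fintype.ofFinite ((linearIndepOn_empty ℂ id).extend (Set.empty_subset O))
  have := b.index_nonempty
  exact interior_convexHull_nonempty_of_basis hO b fun i ↦
    Module.Basis.ofSpan_subset hspan.ge (Set.mem_range_self i)

section MaxEnt

variable {d₁ d₂ : ℕ} {ψ : Fin d₁ × Fin d₂ → ℂ}

theorem MaxEnt.sum_mul_star (h : MaxEnt d₁ d₂ ψ) :
    (of fun i k ↦ ψ (i, k))ᴴ * (of fun i k ↦ ψ (i, k)) =
      (d₂ : ℂ)⁻¹ • (1 : Matrix (Fin d₂) (Fin d₂) ℂ) := by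
  obtain ⟨a, b, ha, hb, h⟩ := h
  set A : Matrix (Fin d₁) (Fin d₂) ℂ := of fun i j ↦ a j i with hA
  set B : Matrix (Fin d₂) (Fin d₂) ℂ := of fun k j ↦ b j k with hB
  have hAA : Aᴴ * A = 1 := by
    ext i j; simpa [mul_apply, one_apply, hA] using ha i j
  have hBB : B * Bᴴ = 1 := by
    rw [mul_eq_one_comm]
    ext i j; simpa [mul_apply, one_apply, hB] using hb i j
  have hΨ : (of fun i k ↦ ψ (i, k)) = ((Real.sqrt d₂ : ℂ))⁻¹ • (A * Bᵀ) := by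
    ext i k; simp [mul_apply, h, hA, hB]
  have hs : ((Real.sqrt d₂ : ℂ))⁻¹ * ((Real.sqrt d₂ : ℂ))⁻¹ = (d₂ : ℂ)⁻¹ := by
    rw [← mul_inv, ← Complex.ofReal_mul, Real.mul_self_sqrt (Nat.cast_nonneg _)]
    simp
  have hs' : star ((Real.sqrt d₂ : ℂ))⁻¹ = ((Real.sqrt d₂ : ℂ))⁻¹ := by simp
  rw [hΨ, conjTranspose_smul, Matrix.smul_mul, Matrix.mul_smul, smul_smul, hs', hs,
    conjTranspose_mul, Matrix.mul_assoc,
    ← Matrix.mul_assoc Aᴴ, hAA, one_mul]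
  congr 1
  have := congrArg transpose hBB
  rwa [transpose_mul, transpose_one] at this

theorem trace_pureState_mul_one_kronecker (C : Matrix (Fin d₂) (Fin d₂) ℂ) :
    (pureState ψ * ((1 : Matrix (Fin d₁) (Fin d₁) ℂ) ⊗ₖ C)).trace =
      ((of fun i k ↦ ψ (i, k))ᴴ * (of fun i k ↦ ψ (i, k)) * Cᵀ).trace := by
  rw [pureState, vecMulVec_mul, trace_vecMulVec, Matrix.mul_assoc, trace_mul_comm, dotProduct,
    Fintype.sum_prod_type]
  simp only [trace, diag_apply, mul_apply, vecMul, dotProduct, Fintype.sum_prod_type,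
    kronecker_apply, one_apply, Pi.star_apply, of_apply, conjTranspose_apply, transpose_apply,
    ite_mul, one_mul, zero_mul, mul_ite, mul_zero, Finset.sum_ite_irrel, Finset.sum_const_zero,
    Finset.sum_ite_eq', Finset.mem_univ, if_true, Finset.sum_mul, Finset.mul_sum]
  refine Finset.sum_congr rfl fun i _ ↦ ?_
  rw [Finset.sum_comm]
  refine Finset.sum_congr rfl fun k _ ↦ Finset.sum_congr rfl fun l _ ↦ ?_
  ring

theorem MaxEnt.trace_mul_one_kronecker (h : MaxEnt d₁ d₂ ψ) {X}
    (hX : X ∈ convexHull ℝ (localOrbit d₁ d₂ (pureState ψ))) {C : Matrix (Fin d₂) (Fin d₂) ℂ}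
    (hC : C.trace = 0) : (X * ((1 : Matrix (Fin d₁) (Fin d₁) ℂ) ⊗ₖ C)).trace = 0 := by
  let f := traceLinearMap (Fin d₁ × Fin d₂) ℝ ℂ ∘ₗ
    LinearMap.mulRight ℝ ((1 : Matrix (Fin d₁) (Fin d₁) ℂ) ⊗ₖ C)
  refine convexHull_min (t := (f.ker : Set _)) ?_ (Submodule.convex _) hX
  rintro _ ⟨U, hU, V, hV, rfl⟩
  change ((U ⊗ₖ V) * pureState ψ * (U ⊗ₖ V)ᴴ * ((1 : Matrix (Fin d₁) (Fin d₁) ℂ) ⊗ₖ C)).trace = 0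
  rw [mem_unitaryGroup_iff', star_eq_conjTranspose] at hU
  rw [mem_unitaryGroup_iff, star_eq_conjTranspose] at hV
  rw [Matrix.mul_assoc, Matrix.mul_assoc, trace_mul_comm, Matrix.mul_assoc,
    conjTranspose_kronecker, Matrix.mul_assoc, ← mul_kronecker_mul, ← mul_kronecker_mul, one_mul,
    hU, trace_pureState_mul_one_kronecker, h.sum_mul_star, smul_mul_assoc, one_mul, trace_smul,
    trace_transpose, trace_mul_comm, Matrix.mul_assoc, hV, mul_one, hC, smul_zero]

theorem maxEnt_of_sum_mul_star {c : ℂ} (hψ : IsUnitVec ψ)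
    (h : ∀ k l, ∑ i, ψ (i, k) * star (ψ (i, l)) = if k = l then c else 0) : MaxEnt d₁ d₂ ψ := by
  have hc : d₂ * c = 1 := by
    have := (pureState_mem_traceOne hψ).2
    rw [pureState, trace_vecMulVec, dotProduct, Fintype.sum_prod_type_right] at this
    simp only [Pi.star_apply, h] at this
    simpa using this
  have hd : (d₂ : ℂ) ≠ 0 := left_ne_zero_of_mul_eq_one hc
  have hs : ((Real.sqrt d₂ : ℂ)) * ((Real.sqrt d₂ : ℂ)) = (d₂ : ℂ) := by
    rw [← Complex.ofReal_mul, Real.mul_self_sqrt (Nat.cast_nonneg _), Complex.ofReal_natCast]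
  have hs0 : ((Real.sqrt d₂ : ℂ)) ≠ 0 := by
    intro h0; rw [h0, mul_zero] at hs; exact hd hs.symm
  refine ⟨fun j i ↦ Real.sqrt d₂ * ψ (i, j), fun j ↦ Pi.single j 1, fun k l ↦ ?_, fun k l ↦ ?_, ?_⟩
  · calc _ = ((Real.sqrt d₂ : ℂ)) * ((Real.sqrt d₂ : ℂ)) * ∑ i, ψ (i, l) * star (ψ (i, k)) := by
          rw [Finset.mul_sum]
          refine Finset.sum_congr rfl fun i _ ↦ ?_
          simp only [map_mul, Complex.conj_ofReal, Complex.star_def]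
          ring
      _ = _ := by
          rw [h, hs]
          by_cases hkl : k = l
          · simp [hkl, hc]
          · simp [hkl, Ne.symm hkl]
  · by_cases hkl : k = l
    · simp [hkl, Pi.single_apply]
    · simp [hkl, Ne.symm hkl, Pi.single_apply]
  · rintro ⟨i, k⟩
    simp [Pi.single_apply, hs0]

theorem maxEnt_of_sum_star_mul {c : ℂ} (hd : d₂ ≤ d₁) (hψ : IsUnitVec ψ)
    (h : ∀ i j, ∑ k, ψ (i, k) * star (ψ (j, k)) = if i = j then c else 0) : MaxEnt d₁ d₂ ψ := by
  have hc : d₁ * c = 1 := by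
    have := (pureState_mem_traceOne hψ).2
    rw [pureState, trace_vecMulVec, dotProduct, Fintype.sum_prod_type] at this
    simp only [Pi.star_apply, h] at this
    simpa using this
  set Ψ : Matrix (Fin d₁) (Fin d₂) ℂ := of fun i k ↦ ψ (i, k) with hΨ
  have h1 : Ψ * ((d₁ : ℂ) • Ψᴴ) = 1 := by
    ext i j
    have := h i j
    simp only [mul_apply, hΨ, Matrix.smul_apply, conjTranspose_apply, of_apply, smul_eq_mul,
      one_apply]
    simp only [mul_left_comm, ← Finset.mul_sum, this, mul_ite, hc, mul_zero]
  have hle : d₁ ≤ d₂ := by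
    have := rank_mul_le_left Ψ ((d₁ : ℂ) • Ψᴴ)
    rw [h1, rank_one, Fintype.card_fin] at this
    simpa using this.trans Ψ.rank_le_card_width
  obtain rfl := le_antisymm hd hle
  rw [mul_eq_one_comm] at h1
  refine maxEnt_of_sum_mul_star (c := c) hψ fun k l ↦ ?_
  have h2 := congrFun (congrFun h1 l) k
  simp only [mul_apply, hΨ, Matrix.smul_apply, conjTranspose_apply, of_apply, smul_eq_mul,
    one_apply, mul_assoc, ← Finset.mul_sum] at h2
  have hd0 : (d₂ : ℂ) ≠ 0 := left_ne_zero_of_mul_eq_one hc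
  refine mul_left_cancel₀ hd0 ?_
  simp only [mul_comm (ψ _), h2, mul_ite, hc, mul_zero, eq_comm]

theorem MaxEnt.interior_eq_empty (h2 : 1 < d₂) (h : MaxEnt d₁ d₂ ψ) (hd : d₂ ≤ d₁) :
    interior ((Subtype.val : traceOne (Fin d₁ × Fin d₂) →
      Matrix (Fin d₁ × Fin d₂) (Fin d₁ × Fin d₂) ℂ) ⁻¹'
        (convexHull ℝ (localOrbit d₁ d₂ (pureState ψ)))) = ∅ := by
  rw [Set.eq_empty_iff_forall_notMem]
  intro A hA
  let x : Fin d₂ := ⟨0, by lia⟩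
  let y : Fin d₂ := ⟨1, h2⟩
  have hxy : x ≠ y := by simp [x, y]
  set C : Matrix (Fin d₂) (Fin d₂) ℂ := single x x 1 - single y y 1 with hC
  have hCtr : C.trace = 0 := by simp [hC]
  have hCH : Cᴴ = C := by simp [hC]
  set D : Matrix (Fin d₁ × Fin d₂) (Fin d₁ × Fin d₂) ℂ := 1 ⊗ₖ C with hD
  have hDH : Dᴴ = D := by rw [hD, conjTranspose_kronecker, hCH, conjTranspose_one]
  have hDtr : D.trace = 0 := by rw [hD, trace_kronecker, hCtr, mul_zero]
  have hDD : (D * D).trace ≠ 0 := by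
    rw [hD, ← mul_kronecker_mul, trace_kronecker]
    have : (C * C).trace = 2 := by
      simp [hC, mul_sub, sub_mul, single_mul_single_of_ne (1 : ℂ) _ _ _ hxy,
        single_mul_single_of_ne (1 : ℂ) _ _ _ hxy.symm]
      norm_num
    rw [this]
    simp
    lia
  let g : ℝ → traceOne (Fin d₁ × Fin d₂) := fun t ↦ ⟨A + (t : ℂ) • D, by
    refine ⟨?_, by rw [trace_add, trace_smul, hDtr, smul_zero, add_zero, A.2.2]⟩
    rw [IsHermitian, conjTranspose_add, conjTranspose_smul, hDH, A.2.1.eq]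
    simp⟩
  have hg : Continuous g := by
    refine Continuous.subtype_mk ?_ _
    fun_prop
  have hg0 : g 0 = A := by ext1; simp [g]
  have hev : ∀ᶠ t in nhds (0 : ℝ), g t ∈ interior (Subtype.val ⁻¹'
      (convexHull ℝ (localOrbit d₁ d₂ (pureState ψ)))) :=
    hg.continuousAt.eventually_mem (isOpen_interior.mem_nhds (by rwa [hg0]))
  obtain ⟨t, ht, ht0⟩ :=
    ((hev.filter_mono nhdsWithin_le_nhds).and (self_mem_nhdsWithin (s := {0}ᶜ))).exists
  have ht' := interior_subset ht
  have hA' := interior_subset hA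
  have e1 := h.trace_mul_one_kronecker ht' hCtr
  have e0 := h.trace_mul_one_kronecker hA' hCtr
  rw [← hD] at e0 e1
  simp only [g, add_mul, trace_add, e0, zero_add, smul_mul_assoc, trace_smul, smul_eq_mul,
    mul_eq_zero, hDD, or_false, Complex.ofReal_eq_zero] at e1
  exact ht0 e1

end MaxEnt

theorem stmt5 (d₁ d₂ : ℕ) (hd : d₂ ≤ d₁) (h2 : 1 < d₂)
    (ψ : Fin d₁ × Fin d₂ → ℂ) (hψ : IsUnitVec ψ) :
    MaxEnt d₁ d₂ ψ ↔
      interior ((Subtype.val : traceOne (Fin d₁ × Fin d₂) → Matrix (Fin d₁ × Fin d₂) (Fin d₁ × Fin d₂) ℂ) ⁻¹'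
        (convexHull ℝ (localOrbit d₁ d₂ (pureState ψ)))) = ∅ := by
  refine ⟨fun h ↦ h.interior_eq_empty h2 hd, fun h ↦ ?_⟩
  by_contra hme
  have : Nontrivial (Fin d₂) := Fin.nontrivial_iff_two_le.2 h2
  have : Nontrivial (Fin d₁) := Fin.nontrivial_iff_two_le.2 (h2.trans_le hd)
  have hmem := pureState_mem_traceOne hψ
  have htop : Submodule.span ℂ (localOrbit d₁ d₂ (pureState ψ)) = ⊤ := by
    refine isLocalIdeal_span_localOrbit.eq_top_of_pureState_mem hmem.2
      (Submodule.subset_span self_mem_localOrbit) ?_ ?_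
    · rintro ⟨c, hc⟩
      exact hme (maxEnt_of_sum_star_mul hd hψ hc)
    · rintro ⟨c, hc⟩
      exact hme (maxEnt_of_sum_mul_star hψ hc)
  exact (interior_convexHull_nonempty_of_span_eq_top
    (localOrbit_subset_traceOne hmem) htop).ne_empty h

end
end

section
/- Let H₁, H₂ be finite-dimensional complex Hilbert spaces with dim(H₁) ≥ dim(H₂) > 1, H = H₁⊗H₂, and let ψ ∈ H be a maximally entangled unit vector. Then the convex hull Conv(K·P_ψ) of the orbit of P_ψ under the local unitary group K = U(H₁)×U(H₂) is a convex body in the affine space 𝕀_H + su*(H₁)⊗su*(H₂), i.e., it has nonempty interior in that affine subspace of the Hermitian operators on H. -/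
open Matrix
open scoped Kronecker

noncomputable section

/-- The set of traceless Hermitian matrices (`su*(H)`). -/
def suSet (n : Type*) [Fintype n] [DecidableEq n] : Set (Matrix n n ℂ) :=
  {A | A.IsHermitian ∧ A.trace = 0}

/-- The real subspace `su*(H₁) ⊗ su*(H₂)` of Hermitian operators on `H₁ ⊗ H₂`: the real
span of Kronecker products `A ⊗ B` with `A`, `B` traceless Hermitian. -/
def suKronSu (d₁ d₂ : ℕ) : Submodule ℝ (Matrix (Fin d₁ × Fin d₂) (Fin d₁ × Fin d₂) ℂ) :=
  Submodule.span ℝ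
    {M | ∃ A ∈ suSet (Fin d₁), ∃ B ∈ suSet (Fin d₂), M = A ⊗ₖ B}

/-- The affine subspace `𝕀_H + su*(H₁) ⊗ su*(H₂)` of the Hermitian operators on
`H = H₁ ⊗ H₂`, where `𝕀_H = I_H / dim H`. -/
def affMax (d₁ d₂ : ℕ) : Set (Matrix (Fin d₁ × Fin d₂) (Fin d₁ × Fin d₂) ℂ) :=
  {M | ∃ B ∈ suKronSu d₁ d₂, M = (((d₁ * d₂ : ℕ) : ℂ))⁻¹ • 1 + B}

theorem interior_preimage_translate_nonempty {E : Type*} [NormedAddCommGroup E]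
    [NormedSpace ℝ E] [FiniteDimensional ℝ E] (V : Submodule ℝ E) (c : E) {C : Set E}
    (hC : Convex ℝ C) (hc : c ∈ C)
    (hV : V ≤ Submodule.span ℝ {x | x ∈ V ∧ ∃ t : ℝ, t ≠ 0 ∧ c + t • x ∈ C}) :
    (interior ((Subtype.val : {M | ∃ B ∈ V, M = c + B} → E) ⁻¹' C)).Nonempty := by
  set D : Set V := {v | c + (v : E) ∈ C} with hD
  have hDconv : Convex ℝ D := by
    intro x hx y hy a b ha hb hab
    have h := hC hx hy ha hb hab
    have e : c + ((a • x + b • y : V) : E) = a • (c + (x : E)) + b • (c + (y : E)) := by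
      have : c = (a + b) • c := by rw [hab, one_smul]
      nth_rewrite 1 [this]
      push_cast
      module
    show c + ((a • x + b • y : V) : E) ∈ C
    rwa [e]
  have h0 : (0 : V) ∈ D := by simpa [hD] using hc
  have hspan : Submodule.span ℝ D = ⊤ := by
    rw [eq_top_iff]
    rintro ⟨v, hv⟩ -
    have hle : Submodule.span ℝ {x | x ∈ V ∧ ∃ t : ℝ, t ≠ 0 ∧ c + t • x ∈ C} ≤
        (Submodule.span ℝ D).map V.subtype := by
      rw [Submodule.span_le]
      rintro x ⟨hx, t, ht, hxt⟩
      refine ⟨⟨x, hx⟩, ?_, rfl⟩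
      have hm : t • (⟨x, hx⟩ : V) ∈ Submodule.span ℝ D := Submodule.subset_span hxt
      have := Submodule.smul_mem _ t⁻¹ hm
      rwa [smul_smul, inv_mul_cancel₀ ht, one_smul] at this
    obtain ⟨w, hw, hwv⟩ := hle (hV hv)
    rwa [show (⟨v, hv⟩ : V) = w from Subtype.ext hwv.symm]
  have haff : affineSpan ℝ D = ⊤ := by
    rw [← SetLike.coe_set_eq, ← Set.insert_eq_of_mem h0, affineSpan_insert_zero, hspan]
    rfl
  obtain ⟨v, hv⟩ := hDconv.interior_nonempty_iff_affineSpan_eq_top.2 haff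
  obtain ⟨O, hOD, hO, hvO⟩ := mem_interior.1 hv
  obtain ⟨W, hW, rfl⟩ := isOpen_induced_iff.1 hO
  refine ⟨⟨c + v, v, v.2, rfl⟩, mem_interior.2
    ⟨(fun M => (M : E) - c) ⁻¹' W, ?_, hW.preimage (by fun_prop), by simpa using hvO⟩⟩
  rintro ⟨M, B, hB, rfl⟩ hM
  have : (⟨B, hB⟩ : V) ∈ D := hOD (by simpa using hM)
  exact this

theorem sum_pureState_col {n : Type*} [Fintype n] [DecidableEq n] {U : Matrix n n ℂ}
    (hU : U ∈ unitaryGroup n ℂ) : ∑ i, pureState (U.col i) = 1 := by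
  rw [← mem_unitaryGroup_iff.1 hU]
  ext p q
  simp [pureState, vecMulVec_apply, Matrix.sum_apply, Matrix.mul_apply, star_apply]

theorem isHermitian_pureState {n : Type*} [Fintype n] (ψ : n → ℂ) :
    (pureState ψ).IsHermitian := by
  ext p q
  simp [pureState, vecMulVec_apply, mul_comm]

theorem trace_pureState_col {n : Type*} [Fintype n] [DecidableEq n] {U : Matrix n n ℂ}
    (hU : U ∈ unitaryGroup n ℂ) (i : n) : (pureState (U.col i)).trace = 1 := by
  have h := congrFun (congrFun (mem_unitaryGroup_iff'.1 hU) i) i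
  simpa [pureState, trace, vecMulVec_apply, Matrix.mul_apply, star_apply, mul_comm] using h

theorem exists_eq_sum_pureState_col {n : Type*} [Fintype n] [DecidableEq n]
    {A : Matrix n n ℂ} (hA : A ∈ suSet n) :
    ∃ U ∈ unitaryGroup n ℂ, ∃ a : n → ℝ, ∑ i, a i = 0 ∧
      A = ∑ i, a i • pureState (U.col i) := by
  obtain ⟨hH, htr⟩ := hA
  refine ⟨hH.eigenvectorUnitary, hH.eigenvectorUnitary.2, hH.eigenvalues, ?_, ?_⟩
  · rw [hH.trace_eq_sum_eigenvalues] at htr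
    exact Complex.ofReal_eq_zero.1 (by rw [Complex.ofReal_sum]; exact htr)
  · conv_lhs => rw [hH.spectral_theorem]
    ext p q
    rw [Unitary.conjStarAlgAut_apply, Matrix.mul_apply]
    simp only [mul_diagonal, Matrix.sum_apply, Matrix.smul_apply, pureState, vecMulVec_apply,
      star_apply, Pi.star_apply, col_apply, Function.comp_apply, Complex.real_smul]
    refine Finset.sum_congr rfl fun i _ => ?_
    simp only [Complex.coe_algebraMap, RCLike.star_def]
    ring

theorem ONFamily.exists_unitary_col {d₁ d₂ : ℕ} (hd : d₂ ≤ d₁) {a : Fin d₂ → Fin d₁ → ℂ}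
    (ha : ONFamily a) :
    ∃ U ∈ unitaryGroup (Fin d₁) ℂ, ∀ j, U.col (Fin.castLE hd j) = a j := by
  classical
  let v : Fin d₁ → EuclideanSpace ℂ (Fin d₁) := fun i =>
    if h : (i : ℕ) < d₂ then WithLp.toLp 2 (a ⟨i, h⟩) else 0
  have hv : Orthonormal ℂ ((Set.range (Fin.castLE hd)).domRestrict v) := by
    rw [orthonormal_iff_ite]
    rintro ⟨_, i, rfl⟩ ⟨_, j, rfl⟩
    have hij : (⟨Fin.castLE hd i, Set.mem_range_self i⟩ : Set.range (Fin.castLE hd)) =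
        ⟨Fin.castLE hd j, Set.mem_range_self j⟩ ↔ i = j := by
      rw [Subtype.mk_eq_mk, Fin.castLE_inj]
    rw [if_congr hij rfl rfl, ← ha i j, PiLp.inner_apply]
    simp [v, mul_comm]
  obtain ⟨b, hb⟩ := hv.exists_orthonormalBasis_extension_of_card_eq (by simp)
  refine ⟨Matrix.of fun p i => b i p, ?_, fun j => ?_⟩
  · rw [mem_unitaryGroup_iff']
    ext i j
    have h := orthonormal_iff_ite.1 b.orthonormal i j
    rw [PiLp.inner_apply] at h
    rw [one_apply, ← h]
    simp [Matrix.mul_apply, star_apply, mul_comm]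
  · funext p
    have := hb _ ⟨j, rfl⟩
    show b _ p = _
    rw [this]
    simp [v]

theorem MaxEnt.pureState_mem_localOrbit {d₁ d₂ : ℕ} (hd : d₂ ≤ d₁)
    {ψ φ : Fin d₁ × Fin d₂ → ℂ} (hψ : MaxEnt d₁ d₂ ψ) (hφ : MaxEnt d₁ d₂ φ) :
    pureState φ ∈ localOrbit d₁ d₂ (pureState ψ) := by
  have key : ∀ {d : ℕ} (h : d₂ ≤ d) {a a' : Fin d₂ → Fin d → ℂ}, ONFamily a → ONFamily a' →
      ∃ U ∈ unitaryGroup (Fin d) ℂ, ∀ j, U *ᵥ a j = a' j := by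
    intro d h a a' ha ha'
    obtain ⟨U, hU, hUa⟩ := ha.exists_unitary_col h
    obtain ⟨U', hU', hUa'⟩ := ha'.exists_unitary_col h
    refine ⟨U' * star U, mul_mem hU' (Unitary.star_mem hU), fun j => ?_⟩
    rw [← hUa, ← hUa', ← mulVec_single_one, mulVec_mulVec, Matrix.mul_assoc,
      mem_unitaryGroup_iff'.1 hU, Matrix.mul_one, mulVec_single_one]
  obtain ⟨a, b, ha, hb, hψ⟩ := hψ
  obtain ⟨a', b', ha', hb', hφ⟩ := hφ
  obtain ⟨U₁, hU₁, h₁⟩ := key hd ha ha'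
  obtain ⟨U₂, hU₂, h₂⟩ := key le_rfl hb hb'
  refine ⟨U₁, hU₁, U₂, hU₂, ?_⟩
  have hφψ : φ = (U₁ ⊗ₖ U₂) *ᵥ ψ := by
    funext ⟨p, q⟩
    simp only [hφ, ← h₁, ← h₂, mulVec, dotProduct, kroneckerMap_apply, hψ, Finset.sum_mul_sum,
      Fintype.sum_prod_type]
    simp only [Finset.mul_sum]
    rw [Finset.sum_comm]
    refine Finset.sum_congr rfl fun x _ => ?_
    rw [Finset.sum_comm]
    refine Finset.sum_congr rfl fun y _ => ?_
    refine Finset.sum_congr rfl fun j _ => ?_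
    ring
  rw [hφψ, pureState, pureState, star_mulVec, ← vecMulVec_mul, ← mul_vecMulVec]

theorem sum_signs_pureState {ι n : Type*} [Fintype ι] [DecidableEq ι] [Fintype n]
    (x : ι → n → ℂ) :
    ∑ s : ι → ℤˣ, pureState (fun p => ∑ j, ((s j : ℤ) : ℂ) * x j p) =
      (Fintype.card (ι → ℤˣ) : ℝ) • ∑ j, pureState (x j) := by
  have orth : ∀ j k : ι, ∑ s : ι → ℤˣ, ((s j : ℤ) : ℂ) * ((s k : ℤ) : ℂ) =
      if j = k then (Fintype.card (ι → ℤˣ) : ℂ) else 0 := by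
    intro j k
    split_ifs with h
    · subst h
      have : ∀ s : ι → ℤˣ, ((s j : ℤ) : ℂ) * ((s j : ℤ) : ℂ) = 1 := by
        intro s
        rcases Int.units_eq_one_or (s j) with h | h <;> simp [h]
      simp [this]
    · have e := Equiv.sum_comp (Equiv.mulLeft (Pi.mulSingle j (-1 : ℤˣ) : ι → ℤˣ))
        (fun s : ι → ℤˣ => ((s j : ℤ) : ℂ) * ((s k : ℤ) : ℂ))
      simp only [Equiv.coe_mulLeft, Pi.mul_apply, Pi.mulSingle_eq_same,
        Pi.mulSingle_eq_of_ne (Ne.symm h)] at e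
      simp only [Units.val_neg, one_mul, neg_mul, Int.cast_neg, Finset.sum_neg_distrib] at e
      exact self_eq_neg.1 e.symm
  ext p q
  simp only [pureState, vecMulVec_apply, Matrix.sum_apply, Pi.star_apply, star_sum, star_mul',
    Matrix.smul_apply, Complex.real_smul, Finset.sum_mul_sum]
  rw [Finset.sum_comm, Finset.mul_sum]
  refine Finset.sum_congr rfl fun j _ => ?_
  rw [Finset.sum_comm]
  have : ∀ k, ∑ s : ι → ℤˣ, ((s j : ℤ) : ℂ) * x j p * (star ((s k : ℤ) : ℂ) * star (x k q)) =
      if j = k then (Fintype.card (ι → ℤˣ) : ℂ) * (x j p * star (x k q)) else 0 := by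
    intro k
    rw [← ite_zero_mul, ← orth, Finset.sum_mul]
    refine Finset.sum_congr rfl fun s _ => ?_
    simp only [RCLike.star_def, map_intCast]
    ring
  simp_rw [this]
  simp

/-- The uniform mixture of the product states `u_{f j} ⊗ v_j`, where `u` and `v` are the columns
of `U` and `V`. -/
def correlatedState {d₁ d₂ : ℕ} (U : Matrix (Fin d₁) (Fin d₁) ℂ) (V : Matrix (Fin d₂) (Fin d₂) ℂ)
    (f : Fin d₂ → Fin d₁) : Matrix (Fin d₁ × Fin d₂) (Fin d₁ × Fin d₂) ℂ :=
  (d₂ : ℝ)⁻¹ • ∑ j, pureState (U.col (f j)) ⊗ₖ pureState (V.col j)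

theorem correlatedState_mem_convexHull {d₁ d₂ : ℕ} (hd : d₂ ≤ d₁)
    {ψ : Fin d₁ × Fin d₂ → ℂ} (hψ : MaxEnt d₁ d₂ ψ)
    {U : Matrix (Fin d₁) (Fin d₁) ℂ} (hU : U ∈ unitaryGroup (Fin d₁) ℂ)
    {V : Matrix (Fin d₂) (Fin d₂) ℂ} (hV : V ∈ unitaryGroup (Fin d₂) ℂ)
    {f : Fin d₂ → Fin d₁} (hf : Function.Injective f) :
    correlatedState U V f ∈ convexHull ℝ (localOrbit d₁ d₂ (pureState ψ)) := by
  have hmem : ∀ s : Fin d₂ → ℤˣ,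
      pureState (fun p : Fin d₁ × Fin d₂ => ∑ j, ((s j : ℤ) : ℂ) *
        ((Real.sqrt d₂ : ℂ)⁻¹ * (U p.1 (f j) * V p.2 j))) ∈
      convexHull ℝ (localOrbit d₁ d₂ (pureState ψ)) := by
    intro s
    refine subset_convexHull ℝ _ (hψ.pureState_mem_localOrbit hd
      ⟨fun j p => ((s j : ℤ) : ℂ) * U p (f j), fun j p => V p j, ?_, ?_, ?_⟩)
    · intro i j
      have h := congrFun (congrFun (mem_unitaryGroup_iff'.1 hU) (f i)) (f j)
      rw [one_apply, Matrix.mul_apply] at h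
      have e : ∑ p, (starRingEnd ℂ) (((s i : ℤ) : ℂ) * U p (f i)) * (((s j : ℤ) : ℂ) * U p (f j))
          = ((s i : ℤ) : ℂ) * ((s j : ℤ) : ℂ) * if f i = f j then 1 else 0 := by
        rw [← h, Finset.mul_sum]
        refine Finset.sum_congr rfl fun p _ => ?_
        simp only [map_mul, map_intCast, star_apply, RCLike.star_def]
        ring
      rw [e]
      simp only [hf.eq_iff]
      split_ifs with hij
      · subst hij
        rcases Int.units_eq_one_or (s i) with h | h <;> simp [h]
      · simp
    · intro i j
      have h := congrFun (congrFun (mem_unitaryGroup_iff'.1 hV) i) j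
      rwa [one_apply, Matrix.mul_apply] at h
    · intro p
      rw [Finset.mul_sum]
      refine Finset.sum_congr rfl fun j _ => ?_
      ring
  have hcard : (Fintype.card (Fin d₂ → ℤˣ) : ℝ) ≠ 0 := by
    exact_mod_cast Fintype.card_ne_zero
  have hsum := (convex_convexHull ℝ (localOrbit d₁ d₂ (pureState ψ))).sum_mem
    (t := Finset.univ) (w := fun _ : Fin d₂ → ℤˣ => (Fintype.card (Fin d₂ → ℤˣ) : ℝ)⁻¹)
    (fun _ _ => by positivity) (by rw [Finset.sum_const, Finset.card_univ, nsmul_eq_mul,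
      mul_inv_cancel₀ hcard]) (fun s _ => hmem s)
  rw [← Finset.smul_sum, sum_signs_pureState, smul_smul, inv_mul_cancel₀ hcard, one_smul] at hsum
  convert hsum using 1
  rw [correlatedState, Finset.smul_sum]
  refine Finset.sum_congr rfl fun j _ => ?_
  have hsq : ((Real.sqrt d₂ : ℝ) : ℂ)⁻¹ * ((Real.sqrt d₂ : ℝ) : ℂ)⁻¹ = ((d₂ : ℝ) : ℂ)⁻¹ := by
    rw [← mul_inv, ← Complex.ofReal_mul, Real.mul_self_sqrt (Nat.cast_nonneg _)]
  ext p q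
  simp only [Matrix.smul_apply, kroneckerMap_apply, pureState, vecMulVec_apply, col_apply,
    Pi.star_apply, Complex.real_smul, star_mul', Complex.ofReal_inv, ← hsq, star_inv₀,
    RCLike.star_def, Complex.conj_ofReal]
  ring

theorem sum_correlatedState_add {d₁ d₂ : ℕ} [NeZero d₁]
    {U : Matrix (Fin d₁) (Fin d₁) ℂ} (hU : U ∈ unitaryGroup (Fin d₁) ℂ)
    {V : Matrix (Fin d₂) (Fin d₂) ℂ} (hV : V ∈ unitaryGroup (Fin d₂) ℂ)
    (f : Fin d₂ → Fin d₁) :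
    ∑ r : Fin d₁, (d₁ : ℝ)⁻¹ • correlatedState U V (fun j => r + f j) =
      (((d₁ * d₂ : ℕ) : ℂ))⁻¹ • 1 := by
  have hshift : ∀ j, ∑ r : Fin d₁, pureState (U.col (r + f j)) = 1 := fun j => by
    rw [← sum_pureState_col hU]
    exact Equiv.sum_comp (Equiv.addRight (f j)) (fun i => pureState (U.col i))
  have e : ∑ r : Fin d₁, ∑ j, pureState (U.col (r + f j)) ⊗ₖ pureState (V.col j) = 1 := by
    rw [Finset.sum_comm, ← one_kronecker_one, ← sum_pureState_col hV]
    ext p q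
    simp only [Matrix.sum_apply, kroneckerMap_apply, ← Finset.sum_mul, Finset.mul_sum]
    refine Finset.sum_congr rfl fun j _ => ?_
    rw [← hshift j, Matrix.sum_apply]
  simp only [correlatedState, ← Finset.smul_sum, e, smul_smul]
  ext p q
  simp [Complex.real_smul, mul_comm]

theorem correlatedState_sub_swap {d₁ d₂ : ℕ} (U : Matrix (Fin d₁) (Fin d₁) ℂ)
    (V : Matrix (Fin d₂) (Fin d₂) ℂ) {f : Fin d₂ → Fin d₁} (hf : Function.Injective f)
    {j l : Fin d₂} (hjl : j ≠ l) :
    correlatedState U V f - correlatedState U V (fun x => Equiv.swap (f j) (f l) (f x)) =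
      (d₂ : ℝ)⁻¹ • ((pureState (U.col (f j)) - pureState (U.col (f l))) ⊗ₖ
        (pureState (V.col j) - pureState (V.col l))) := by
  rw [correlatedState, correlatedState, ← smul_sub, ← Finset.sum_sub_distrib]
  congr 1
  rw [Finset.sum_eq_add j l hjl]
  · rw [Equiv.swap_apply_left, Equiv.swap_apply_right]
    ext p q
    simp only [Matrix.add_apply, Matrix.sub_apply, kroneckerMap_apply]
    ring
  · rintro x - ⟨hxj, hxl⟩
    rw [Equiv.swap_apply_of_ne_of_ne (hf.ne hxj) (hf.ne hxl), sub_self]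
  · simp
  · simp

theorem exists_injective_map_pair {d₁ d₂ : ℕ} (hd : d₂ ≤ d₁) {i k : Fin d₁} (hik : i ≠ k)
    {j l : Fin d₂} (hjl : j ≠ l) :
    ∃ f : Fin d₂ → Fin d₁, Function.Injective f ∧ f j = i ∧ f l = k := by
  have hg := Fin.castLE_injective hd
  set g := Fin.castLE hd
  have hx : Equiv.swap (g j) i (g l) ≠ i := by
    intro h
    rw [Equiv.swap_apply_eq_iff, Equiv.swap_apply_right] at h
    exact hjl (hg h).symm
  refine ⟨fun x => Equiv.swap (Equiv.swap (g j) i (g l)) k (Equiv.swap (g j) i (g x)),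
    fun x y h => hg (by simpa using h), ?_, ?_⟩
  · simp only [Equiv.swap_apply_left]
    exact Equiv.swap_apply_of_ne_of_ne hx.symm hik
  · simp

theorem add_smul_kronecker_mem_convexHull {d₁ d₂ : ℕ} [NeZero d₁] (hd : d₂ ≤ d₁)
    {ψ : Fin d₁ × Fin d₂ → ℂ} (hψ : MaxEnt d₁ d₂ ψ)
    {U : Matrix (Fin d₁) (Fin d₁) ℂ} (hU : U ∈ unitaryGroup (Fin d₁) ℂ)
    {V : Matrix (Fin d₂) (Fin d₂) ℂ} (hV : V ∈ unitaryGroup (Fin d₂) ℂ)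
    {i k : Fin d₁} (hik : i ≠ k) {j l : Fin d₂} (hjl : j ≠ l) :
    (((d₁ * d₂ : ℕ) : ℂ))⁻¹ • 1 + ((d₁ : ℝ)⁻¹ * (d₂ : ℝ)⁻¹) •
      ((pureState (U.col i) - pureState (U.col k)) ⊗ₖ
        (pureState (V.col j) - pureState (V.col l))) ∈
      convexHull ℝ (localOrbit d₁ d₂ (pureState ψ)) := by
  obtain ⟨f, hf, rfl, rfl⟩ := exists_injective_map_pair hd hik hjl
  set g : Fin d₂ → Fin d₁ := fun x => Equiv.swap (f j) (f l) (f x) with hg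
  have hginj : Function.Injective g := (Equiv.injective _).comp hf
  rw [mul_smul, ← correlatedState_sub_swap U V hf hjl, ← sum_correlatedState_add hU hV g]
  have hd₁ : (d₁ : ℝ) ≠ 0 := Nat.cast_ne_zero.2 (NeZero.ne d₁)
  have hsum := (convex_convexHull ℝ (localOrbit d₁ d₂ (pureState ψ))).sum_mem
    (t := Finset.univ) (w := fun _ : Fin d₁ => (d₁ : ℝ)⁻¹)
    (z := fun r => if r = 0 then correlatedState U V f
      else correlatedState U V (fun x => r + g x))
    (fun _ _ => by positivity) (by simp [hd₁]) (fun r _ => by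
      split_ifs
      · exact correlatedState_mem_convexHull hd hψ hU hV hf
      · exact correlatedState_mem_convexHull hd hψ hU hV ((add_right_injective r).comp hginj))
  convert hsum using 1
  rw [Fintype.sum_eq_add_sum_compl 0, Fintype.sum_eq_add_sum_compl (0 : Fin d₁)]
  have hcompl : ∀ r ∈ ({0}ᶜ : Finset (Fin d₁)),
      (d₁ : ℝ)⁻¹ • (if r = 0 then correlatedState U V f
        else correlatedState U V (fun x => r + g x)) =
      (d₁ : ℝ)⁻¹ • correlatedState U V (fun x => r + g x) := by
    intro r hr
    rw [if_neg (by simpa using hr)]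
  rw [Finset.sum_congr rfl hcompl]
  simp only [zero_add, if_true]
  module

theorem pureState_sub_mem_suSet {n : Type*} [Fintype n] [DecidableEq n] {U : Matrix n n ℂ}
    (hU : U ∈ unitaryGroup n ℂ) (i k : n) :
    pureState (U.col i) - pureState (U.col k) ∈ suSet n :=
  ⟨(isHermitian_pureState _).sub (isHermitian_pureState _), by
    rw [trace_sub, trace_pureState_col hU, trace_pureState_col hU, sub_self]⟩

theorem sum_smul_eq_sum_smul_sub {ι M : Type*} [Fintype ι] [AddCommGroup M] [Module ℝ M]
    {a : ι → ℝ} (ha : ∑ i, a i = 0) (x : ι → M) (k : ι) :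
    ∑ i, a i • x i = ∑ i, a i • (x i - x k) := by
  simp [smul_sub, ← Finset.sum_smul, ha]

theorem sum_smul_kronecker_sum_smul {ι κ m n : Type*} [Fintype ι] [Fintype κ]
    (a : ι → ℝ) (X : ι → Matrix m m ℂ) (b : κ → ℝ) (Y : κ → Matrix n n ℂ) :
    (∑ i, a i • X i) ⊗ₖ (∑ j, b j • Y j) = ∑ i, ∑ j, (a i * b j) • (X i ⊗ₖ Y j) := by
  ext p q
  simp only [kroneckerMap_apply, Matrix.sum_apply, Matrix.smul_apply, Finset.sum_mul_sum,
    Complex.real_smul, Complex.ofReal_mul]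
  refine Finset.sum_congr rfl fun i _ => Finset.sum_congr rfl fun j _ => ?_
  ring


/-- if `ψ` is a maximally entangled unit vector of `H₁ ⊗ H₂` with
`dim H₁ ≥ dim H₂ > 1`, the convex hull of the local unitary orbit of `P_ψ` is a convex
body in the affine space `𝕀_H + su*(H₁) ⊗ su*(H₂)`, i.e. has nonempty interior there. -/
theorem stmt6 (d₁ d₂ : ℕ) (hd : d₂ ≤ d₁) (h2 : 1 < d₂)
    (ψ : Fin d₁ × Fin d₂ → ℂ) (hψ : IsUnitVec ψ) (hme : MaxEnt d₁ d₂ ψ) :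
    (interior ((Subtype.val : affMax d₁ d₂ → Matrix (Fin d₁ × Fin d₂) (Fin d₁ × Fin d₂) ℂ) ⁻¹'
      (convexHull ℝ (localOrbit d₁ d₂ (pureState ψ))))).Nonempty := by
  have h₂ : d₂ ≠ 0 := by omega
  have : NeZero d₁ := ⟨by omega⟩
  have : NeZero d₂ := ⟨h₂⟩
  let : NormedAddCommGroup (Matrix (Fin d₁ × Fin d₂) (Fin d₁ × Fin d₂) ℂ) :=
    Matrix.normedAddCommGroup
  let : NormedSpace ℝ (Matrix (Fin d₁ × Fin d₂) (Fin d₁ × Fin d₂) ℂ) := Matrix.normedSpace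
  refine interior_preimage_translate_nonempty (suKronSu d₁ d₂) _ (convex_convexHull ℝ _) ?_ ?_
  · rw [← sum_correlatedState_add (one_mem _) (one_mem _) (Fin.castLE hd)]
    refine (convex_convexHull ℝ _).sum_mem (fun _ _ => by positivity)
      (by simp [NeZero.ne d₁]) fun r _ => ?_
    exact correlatedState_mem_convexHull hd hme (one_mem _) (one_mem _)
      ((add_right_injective r).comp (Fin.castLE_injective hd))
  · conv_lhs => rw [suKronSu]
    rw [Submodule.span_le]
    rintro _ ⟨A, hA, B, hB, rfl⟩
    obtain ⟨U, hU, a, ha, rfl⟩ := exists_eq_sum_pureState_col hA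
    obtain ⟨V, hV, b, hb, rfl⟩ := exists_eq_sum_pureState_col hB
    rw [sum_smul_eq_sum_smul_sub ha _ 0, sum_smul_eq_sum_smul_sub hb _ 0,
      sum_smul_kronecker_sum_smul]
    refine Submodule.sum_mem _ fun i _ => Submodule.sum_mem _ fun j _ =>
      Submodule.smul_mem _ _ ?_
    by_cases hi : i = 0
    · simp [hi]
    by_cases hj : j = 0
    · simp [hj]
    refine Submodule.subset_span ⟨Submodule.subset_span
      ⟨_, pureState_sub_mem_suSet hU i 0, _, pureState_sub_mem_suSet hV j 0, rfl⟩,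
      (d₁ : ℝ)⁻¹ * (d₂ : ℝ)⁻¹, by simp [NeZero.ne d₁, h₂], ?_⟩
    exact add_smul_kronecker_mem_convexHull hd hme hU hV hi hj

end
end
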